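/- arXiv:2401.14473 — 2 statements merged into one kernel-verified Lean document; each statement's English description precedes it below -/
import Mathlib

section
/- If a power series f in the class K with radius of convergence R is strongly Gaussian, then f is a clan: lim_{t↑R} σ_f(t)/m_f(t) = 0. -/
open Filter MeasureTheory Topology Real
open scoped ENNReal

noncomputable section

/-- The filter describing `t ↑ R`: `atTop` if `R = ∞`, else approach `R` from below. -/
def nhdsLT (R : ℝ≥0∞) : Filter ℝ :=
  if R = ⊤ then atTop else nhdsWithin R.toReal (Set.Iio R.toReal)

/-- The class `K`: nonnegative coefficients, `a 0 > 0`, some `a n > 0` with `n ≥ 1`,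
and radius of convergence exactly `R` (all power-type sums converge for `0 < t < R`,
and the basic sum diverges for `t > R`). -/
def IsKClass (a : ℕ → ℝ) (R : ℝ≥0∞) : Prop :=
  (∀ n, 0 ≤ a n) ∧ 0 < a 0 ∧ (∃ n, 1 ≤ n ∧ 0 < a n) ∧
  (∀ β t : ℝ, 0 < t → ENNReal.ofReal t < R →
    Summable (fun n : ℕ => (n : ℝ) ^ β * a n * t ^ n)) ∧
  (∀ t : ℝ, 0 < t → R < ENNReal.ofReal t → ¬ Summable (fun n : ℕ => a n * t ^ n))

/-- `f(t) = Σ aₙ tⁿ`. -/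
def fsum (a : ℕ → ℝ) (t : ℝ) : ℝ := ∑' n : ℕ, a n * t ^ n

/-- `E(X_t^β) = (Σ n^β aₙ tⁿ)/f(t)`. -/
def moment (a : ℕ → ℝ) (β : ℝ) (t : ℝ) : ℝ :=
  (∑' n : ℕ, (n : ℝ) ^ β * a n * t ^ n) / fsum a t

/-- The mean `m_f(t) = E(X_t)`. -/
def mf (a : ℕ → ℝ) (t : ℝ) : ℝ := moment a 1 t

/-- The variance `σ_f²(t) = E(X_t²) − m_f(t)²`. -/
def varf (a : ℕ → ℝ) (t : ℝ) : ℝ := moment a 2 t - (mf a t) ^ 2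

/-- `σ_f(t)`, the nonnegative square root of the variance. -/
def sigmaf (a : ℕ → ℝ) (t : ℝ) : ℝ := Real.sqrt (varf a t)

/-- `f` is a clan if `σ_f(t)/m_f(t) → 0` as `t ↑ R`. -/
def IsClan (a : ℕ → ℝ) (R : ℝ≥0∞) : Prop :=
  Tendsto (fun t => sigmaf a t / mf a t) (nhdsLT R) (𝓝 0)

/-- The holomorphic extension `F(z) = Σ aₙ zⁿ` of `f` to the disk `{|z| < R}` in `ℂ`. -/
def Fc (a : ℕ → ℝ) (z : ℂ) : ℂ := ∑' n : ℕ, (a n : ℂ) * z ^ n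

/-- The characteristic function of the normalized Khinchin family variable:
`E(e^{iθ X̆_t}) = (F(t e^{iθ/σ_f(t)})/f(t))·e^{−iθ m_f(t)/σ_f(t)}`. -/
def charNorm (a : ℕ → ℝ) (t θ : ℝ) : ℂ :=
  (Fc a ((t : ℂ) * Complex.exp (((θ / sigmaf a t : ℝ) : ℂ) * Complex.I)) / (fsum a t : ℂ)) *
    Complex.exp (-((θ * mf a t / sigmaf a t : ℝ) : ℂ) * Complex.I)

lemma aux_summable (a : ℕ → ℝ) (R : ℝ≥0∞) (hK : IsKClass a R) (t : ℝ) (ht : 0 < t)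
    (htR : ENNReal.ofReal t < R) : Summable (fun n : ℕ => a n * t ^ n) := by
  have h := hK.2.2.2.1 0 t ht htR
  simpa using h

lemma aux_eventually (R : ℝ≥0∞) (hR : 0 < R) :
    ∀ᶠ t in nhdsLT R, 0 < t ∧ ENNReal.ofReal t < R := by
  unfold _root_.nhdsLT
  split_ifs with h
  · filter_upwards [eventually_gt_atTop 0] with t ht
    exact ⟨ht, by rw [h]; exact ENNReal.ofReal_lt_top⟩
  · have hp : 0 < R.toReal := ENNReal.toReal_pos hR.ne' h
    filter_upwards [Ioo_mem_nhdsLT hp] with t ht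
    exact ⟨ht.1, (ENNReal.ofReal_lt_iff_lt_toReal ht.1.le h).2 ht.2⟩

lemma aux_term (a : ℕ → ℝ) (t x : ℝ) (n : ℕ) :
    (a n : ℂ) * ((t : ℂ) * Complex.exp ((x : ℂ) * Complex.I)) ^ n
      = ((a n * t ^ n : ℝ) : ℂ) * Complex.exp (((n * x : ℝ) : ℂ) * Complex.I) := by
  rw [mul_pow, ← Complex.exp_nat_mul]
  push_cast
  ring_nf

lemma aux_cont (a : ℕ → ℝ) (ha : ∀ n, 0 ≤ a n) (t s : ℝ) (ht : 0 < t)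
    (hs : Summable (fun n : ℕ => a n * t ^ n)) :
    Continuous (fun θ : ℝ => Fc a ((t : ℂ) * Complex.exp (((θ / s : ℝ) : ℂ) * Complex.I))) := by
  unfold Fc
  refine continuous_tsum (u := fun n => a n * t ^ n) (fun n => by fun_prop) hs ?_
  intro n θ
  rw [aux_term, norm_mul, Complex.norm_exp_ofReal_mul_I, mul_one, Complex.norm_real,
    Real.norm_of_nonneg (mul_nonneg (ha n) (pow_nonneg ht.le n))]

lemma aux_int_exp (s : ℝ) (hs : 0 < s) (n : ℕ) :
    ∫ θ in (-(π * s))..(π * s), Complex.exp ((((n + 1 : ℕ) : ℝ) * (θ / s) : ℝ) * Complex.I) = 0 := by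
  have hsc : (s : ℂ) ≠ 0 := by exact_mod_cast hs.ne'
  have hn : ((n + 1 : ℕ) : ℂ) ≠ 0 := by exact_mod_cast Nat.succ_ne_zero n
  have hc : ((n + 1 : ℕ) : ℂ) / s * Complex.I ≠ 0 :=
    mul_ne_zero (div_ne_zero hn hsc) Complex.I_ne_zero
  have := integral_exp_mul_complex (a := -(π * s)) (b := π * s) hc
  have e : ∀ θ : ℝ, Complex.exp ((((n + 1 : ℕ) : ℝ) * (θ / s) : ℝ) * Complex.I)
      = Complex.exp (((n + 1 : ℕ) : ℂ) / s * Complex.I * θ) := by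
    intro θ
    congr 1
    push_cast
    ring
  simp_rw [e]
  rw [this, div_eq_zero_iff]
  left
  rw [sub_eq_zero, Complex.exp_eq_exp_iff_exists_int]
  refine ⟨n + 1, ?_⟩
  push_cast
  field_simp
  ring

lemma aux_int_zero (a : ℕ → ℝ) (ha : ∀ n, 0 ≤ a n) (t s : ℝ) (ht : 0 < t) (hs0 : 0 < s)
    (hs : Summable (fun n : ℕ => a n * t ^ n)) :
    ∫ θ in (-(π * s))..(π * s), Fc a ((t : ℂ) * Complex.exp (((θ / s : ℝ) : ℂ) * Complex.I)) *
      Complex.exp (((θ / s : ℝ) : ℂ) * Complex.I) = 0 := by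
  have hterm : ∀ (n : ℕ) (θ : ℝ), (a n : ℂ) * ((t : ℂ) * Complex.exp (((θ / s : ℝ) : ℂ) * Complex.I)) ^ n
      * Complex.exp (((θ / s : ℝ) : ℂ) * Complex.I)
      = ((a n * t ^ n : ℝ) : ℂ) * Complex.exp ((((n + 1 : ℕ) : ℝ) * (θ / s) : ℝ) * Complex.I) := by
    intro n θ
    rw [aux_term, mul_assoc, ← Complex.exp_add]
    congr 2
    push_cast
    ring
  have hnorm : ∀ (n : ℕ) (θ : ℝ),
      ‖((a n * t ^ n : ℝ) : ℂ) * Complex.exp ((((n + 1 : ℕ) : ℝ) * (θ / s) : ℝ) * Complex.I)‖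
        = a n * t ^ n := by
    intro n θ
    rw [norm_mul, Complex.norm_exp_ofReal_mul_I, mul_one, Complex.norm_real,
      Real.norm_of_nonneg (mul_nonneg (ha n) (pow_nonneg ht.le n))]
  have key := intervalIntegral.hasSum_integral_of_dominated_convergence (μ := volume)
    (a := -(π * s)) (b := π * s)
    (F := fun (n : ℕ) (θ : ℝ) =>
      ((a n * t ^ n : ℝ) : ℂ) * Complex.exp ((((n + 1 : ℕ) : ℝ) * (θ / s) : ℝ) * Complex.I))
    (f := fun θ : ℝ => Fc a ((t : ℂ) * Complex.exp (((θ / s : ℝ) : ℂ) * Complex.I)) *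
      Complex.exp (((θ / s : ℝ) : ℂ) * Complex.I))
    (fun n _ => a n * t ^ n)
    (fun n => (by fun_prop : Continuous _).aestronglyMeasurable)
    (fun n => Eventually.of_forall fun θ _ => (hnorm n θ).le)
    (Eventually.of_forall fun θ _ => hs)
    intervalIntegrable_const
    (Eventually.of_forall fun θ _ => by
      have h1 : Summable (fun n : ℕ => (a n : ℂ) *
          ((t : ℂ) * Complex.exp (((θ / s : ℝ) : ℂ) * Complex.I)) ^ n) := by
        refine Summable.of_norm_bounded hs fun n => ?_
        rw [aux_term, norm_mul, Complex.norm_exp_ofReal_mul_I, mul_one, Complex.norm_real,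
          Real.norm_of_nonneg (mul_nonneg (ha n) (pow_nonneg ht.le n))]
      have h2 := h1.hasSum.mul_right (Complex.exp (((θ / s : ℝ) : ℂ) * Complex.I))
      simp_rw [hterm] at h2
      exact h2)
  refine key.unique ?_
  have h0 : ∀ n : ℕ, (∫ θ in (-(π * s))..(π * s), ((a n * t ^ n : ℝ) : ℂ) *
      Complex.exp ((((n + 1 : ℕ) : ℝ) * (θ / s) : ℝ) * Complex.I)) = 0 := by
    intro n
    rw [intervalIntegral.integral_const_mul, aux_int_exp s hs0 n, mul_zero]
  simp_rw [h0]
  exact hasSum_zero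

lemma aux_gauss_int : Integrable (fun θ : ℝ => Real.exp (-θ ^ 2 / 2)) := by
  have h := integrable_exp_neg_mul_sq (b := 1 / 2) (by norm_num)
  refine h.congr (Eventually.of_forall fun θ => ?_)
  simp only
  congr 1
  ring

lemma aux_fourier (s : ℝ) :
    ∫ θ : ℝ, ((Real.exp (-θ ^ 2 / 2) : ℝ) : ℂ) * Complex.exp (((θ * s : ℝ) : ℂ) * Complex.I)
      = ((√(2 * π) * Real.exp (-s ^ 2 / 2) : ℝ) : ℂ) := by
  have h := fourierIntegral_gaussian (b := 1 / 2) (by norm_num) (s : ℂ)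
  have e : ∀ θ : ℝ, ((Real.exp (-θ ^ 2 / 2) : ℝ) : ℂ) * Complex.exp (((θ * s : ℝ) : ℂ) * Complex.I)
      = Complex.exp (Complex.I * s * θ) * Complex.exp (-(1 / 2) * (θ : ℂ) ^ 2) := by
    intro θ
    rw [Complex.ofReal_exp, mul_comm]
    congr 2
    · push_cast; ring
    · push_cast; ring
  simp_rw [e]
  rw [h]
  have h2 : (π / (1 / 2) : ℂ) = ((2 * π : ℝ) : ℂ) := by push_cast; ring
  rw [h2, Real.sqrt_eq_rpow, Complex.ofReal_mul (_ ^ _), Complex.ofReal_cpow (by positivity), Complex.ofReal_exp]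
  congr 2
  · push_cast; rfl
  · push_cast; ring

lemma aux_bound (a : ℕ → ℝ) (R : ℝ≥0∞) (hK : IsKClass a R) (t : ℝ) (ht : 0 < t)
    (htR : ENNReal.ofReal t < R) (hs : 0 < sigmaf a t) :
    √(2 * π) * Real.exp (-((mf a t + 1) / sigmaf a t) ^ 2 / 2) ≤
      (∫ θ in Set.Ioo (-(Real.pi * sigmaf a t)) (Real.pi * sigmaf a t),
          ‖charNorm a t θ - ((Real.exp (-θ ^ 2 / 2) : ℝ) : ℂ)‖) +
      ((∫ θ : ℝ, Real.exp (-θ ^ 2 / 2)) -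
        ∫ θ in (-(π * sigmaf a t))..(π * sigmaf a t), Real.exp (-θ ^ 2 / 2)) := by
  have hsum := aux_summable a R hK t ht htR
  have hcont := aux_cont a hK.1 t (sigmaf a t) ht hsum
  have hzero := aux_int_zero a hK.1 t (sigmaf a t) ht hs hsum
  set s := sigmaf a t with hsdef
  set u := (mf a t + 1) / s with hu
  set E : ℝ → ℂ := fun θ => Complex.exp (((θ * u : ℝ) : ℂ) * Complex.I) with hE
  set G : ℝ → ℂ := fun θ => ((Real.exp (-θ ^ 2 / 2) : ℝ) : ℂ) with hG
  have hEc : Continuous E := by fun_prop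
  have hGc : Continuous G := by fun_prop
  have hEn : ∀ θ, ‖E θ‖ = 1 := fun θ => Complex.norm_exp_ofReal_mul_I _
  have hGn : ∀ θ, ‖G θ‖ = Real.exp (-θ ^ 2 / 2) := fun θ => by
    rw [hG, Complex.norm_real, Real.norm_of_nonneg (Real.exp_pos _).le]
  have hle : -(π * s) ≤ π * s := by have := mul_pos Real.pi_pos hs; linarith
  have hCc : Continuous (charNorm a t) := by
    unfold charNorm
    rw [← hsdef]
    refine (hcont.div_const _).mul ?_
    fun_prop
  have hC0 : ∫ θ in (-(π * s))..(π * s), charNorm a t θ * E θ = 0 := by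
    have e : ∀ θ, charNorm a t θ * E θ = (fsum a t : ℂ)⁻¹ *
        (Fc a ((t : ℂ) * Complex.exp (((θ / s : ℝ) : ℂ) * Complex.I)) *
      Complex.exp (((θ / s : ℝ) : ℂ) * Complex.I)) := by
      intro θ
      have : Complex.exp (((θ / s : ℝ) : ℂ) * Complex.I)
        = Complex.exp (-((θ * mf a t / s : ℝ) : ℂ) * Complex.I) * E θ := by
        rw [hE, ← Complex.exp_add]
        congr 1
        rw [hu]
        push_cast
        ring
      unfold charNorm
      rw [← hsdef]
      generalize Fc a _ = w
      rw [this]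
      ring
    simp_rw [e]
    rw [intervalIntegral.integral_const_mul, hzero, mul_zero]
  have hGE : Integrable (fun θ => G θ * E θ) := by
    refine aux_gauss_int.mono' (hGc.mul hEc).aestronglyMeasurable
      (Eventually.of_forall fun θ => ?_)
    rw [norm_mul, hEn, mul_one, hGn]
  have h1 : ‖∫ θ in Set.Ioo (-(π * s)) (π * s), G θ * E θ‖ ≤
      ∫ θ in Set.Ioo (-(π * s)) (π * s), ‖charNorm a t θ - G θ‖ := by
    have hd : ∫ θ in (-(π * s))..(π * s), (charNorm a t θ - G θ) * E θ
        = - ∫ θ in (-(π * s))..(π * s), G θ * E θ := by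
      simp_rw [sub_mul]
      have i1 : IntervalIntegrable (fun θ => charNorm a t θ * E θ) volume (-(π * s)) (π * s) :=
        (hCc.mul hEc).intervalIntegrable _ _
      have i2 : IntervalIntegrable (fun θ => G θ * E θ) volume (-(π * s)) (π * s) :=
        (hGc.mul hEc).intervalIntegrable _ _
      rw [intervalIntegral.integral_sub i1 i2, hC0, zero_sub]
    rw [intervalIntegral.integral_of_le hle, intervalIntegral.integral_of_le hle,
      integral_Ioc_eq_integral_Ioo, integral_Ioc_eq_integral_Ioo] at hd
    rw [← norm_neg, ← hd]
    refine (norm_integral_le_integral_norm _).trans (le_of_eq ?_)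
    congr 1
    funext θ
    rw [norm_mul, hEn, mul_one]
  have h2 : ‖∫ θ in (Set.Ioo (-(π * s)) (π * s))ᶜ, G θ * E θ‖ ≤
      ∫ θ in (Set.Ioo (-(π * s)) (π * s))ᶜ, Real.exp (-θ ^ 2 / 2) := by
    refine (norm_integral_le_integral_norm _).trans (le_of_eq ?_)
    congr 1
    funext θ
    rw [norm_mul, hEn, mul_one, hGn]
  have h3 := integral_add_compl (μ := volume) (s := Set.Ioo (-(π * s)) (π * s)) measurableSet_Ioo hGE
  have h4 := integral_add_compl (μ := volume) (s := Set.Ioo (-(π * s)) (π * s)) measurableSet_Ioo aux_gauss_int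
  have h5 : ‖∫ θ, G θ * E θ‖ = √(2 * π) * Real.exp (-u ^ 2 / 2) := by
    rw [hG, hE, aux_fourier u, Complex.norm_real, Real.norm_of_nonneg (by positivity)]
  rw [intervalIntegral.integral_of_le hle, integral_Ioc_eq_integral_Ioo, ← h5, ← h3]
  have := norm_add_le (∫ θ in Set.Ioo (-(π * s)) (π * s), G θ * E θ)
    (∫ θ in (Set.Ioo (-(π * s)) (π * s))ᶜ, G θ * E θ)
  linarith

lemma aux_mf_nonneg (a : ℕ → ℝ) (ha : ∀ n, 0 ≤ a n) (t : ℝ) (ht : 0 < t) : 0 ≤ mf a t := by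
  unfold mf moment fsum
  refine div_nonneg (tsum_nonneg fun n => ?_) (tsum_nonneg fun n => ?_)
  · have := ha n
    positivity
  · have := ha n
    positivity

/-- a strongly Gaussian power series in `K` is a clan. -/
theorem stronglyGaussian_isClan (a : ℕ → ℝ) (R : ℝ≥0∞) (hR : 0 < R)
    (hK : IsKClass a R)
    (hσ : Tendsto (sigmaf a) (nhdsLT R) atTop)
    (hSG : Tendsto (fun t =>
        ∫ θ in Set.Ioo (-(Real.pi * sigmaf a t)) (Real.pi * sigmaf a t),
          ‖charNorm a t θ - ((Real.exp (-θ ^ 2 / 2) : ℝ) : ℂ)‖)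
      (nhdsLT R) (𝓝 0)) :
    IsClan a R := by
  have hev := aux_eventually R hR
  have hpos : ∀ᶠ t in nhdsLT R, 0 < sigmaf a t := hσ.eventually_gt_atTop 0
  have hπσ : Tendsto (fun t => π * sigmaf a t) (nhdsLT R) atTop := hσ.const_mul_atTop Real.pi_pos
  have htail := (intervalIntegral_tendsto_integral aux_gauss_int
    tendsto_neg_atTop_atBot tendsto_id).comp hπσ
  have hup := hSG.add (htail.const_sub (∫ θ : ℝ, Real.exp (-θ ^ 2 / 2)))
  rw [sub_self, add_zero] at hup
  have hlim : Tendsto (fun t => √(2 * π) * Real.exp (-((mf a t + 1) / sigmaf a t) ^ 2 / 2))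
      (nhdsLT R) (𝓝 0) := by
    refine tendsto_of_tendsto_of_tendsto_of_le_of_le' tendsto_const_nhds hup
      (Eventually.of_forall fun t => by positivity) ?_
    filter_upwards [hev, hpos] with t ht hs
    exact aux_bound a R hK t ht.1 ht.2 hs
  have hne : √(2 * π) ≠ 0 := by positivity
  have hexp : Tendsto (fun t => Real.exp (-((mf a t + 1) / sigmaf a t) ^ 2 / 2))
      (nhdsLT R) (𝓝 0) := by
    have := hlim.const_mul (√(2 * π))⁻¹
    rw [mul_zero] at this
    exact this.congr fun t => inv_mul_cancel_left₀ hne _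
  have hbot := Real.tendsto_exp_comp_nhds_zero.1 hexp
  have hs : Tendsto (fun t => (mf a t + 1) / sigmaf a t) (nhdsLT R) atTop := by
    rw [tendsto_atTop]
    intro b
    filter_upwards [hbot.eventually_lt_atBot (-b ^ 2 / 2), hev, hpos] with t h1 ht hp
    have hm := aux_mf_nonneg a hK.1 t ht.1
    have : 0 ≤ (mf a t + 1) / sigmaf a t := by positivity
    nlinarith
  have hinv : Tendsto (fun t => -(sigmaf a t)⁻¹) (nhdsLT R) (𝓝 (-0)) :=
    (tendsto_inv_atTop_zero.comp hσ).neg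
  have hm := hs.atTop_add hinv
  unfold IsClan
  refine (tendsto_inv_atTop_zero.comp hm).congr fun t => ?_
  simp only [Function.comp]
  rw [← inv_div (mf a t)]
  congr 1
  ring
end
end

section
/- Let f be a power series in the class K with radius of convergence R which is a clan. Then for every real p > 0, lim_{t↑R} E(X_t^p)/E(X_t)^p = 1. -/
open Filter MeasureTheory Topology Real
open scoped ENNReal

noncomputable section

lemma nhdsLT_ev (R : ℝ≥0∞) (hR : 0 < R) (P : ℝ → Prop) :
    (∀ᶠ t in nhdsLT R, P t) ↔
      ∃ T, 0 < T ∧ ENNReal.ofReal T < R ∧ ∀ t, T ≤ t → ENNReal.ofReal t < R → P t := by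
  unfold _root_.nhdsLT
  split_ifs with h
  · subst h
    rw [eventually_atTop]
    constructor
    · rintro ⟨T, hT⟩
      exact ⟨max T 1, by positivity, ENNReal.ofReal_lt_top,
        fun t ht _ => hT t (le_trans (le_max_left _ _) ht)⟩
    · rintro ⟨T, _, _, hT⟩
      exact ⟨T, fun t ht => hT t ht ENNReal.ofReal_lt_top⟩
  · have hr : 0 < R.toReal := ENNReal.toReal_pos hR.ne' h
    have key : ∀ t, 0 < t → (ENNReal.ofReal t < R ↔ t < R.toReal) := by
      intro t ht
      rw [ENNReal.ofReal_lt_iff_lt_toReal ht.le h]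
    have := (nhdsLT_basis_of_exists_lt (a := R.toReal) ⟨0, hr⟩).eventually_iff (q := P)
    rw [this]
    constructor
    · rintro ⟨T, hT, hP⟩
      refine ⟨(max T 0 + R.toReal) / 2, by positivity, ?_, ?_⟩
      · rw [key _ (by positivity)]
        have : max T 0 < R.toReal := max_lt hT hr
        linarith
      · intro t ht hlt
        have h1 : max T 0 < R.toReal := max_lt hT hr
        have h2 : max T 0 < t := by linarith
        have h0 : 0 < t := lt_of_le_of_lt (le_max_right _ _) h2
        exact hP ⟨lt_of_le_of_lt (le_max_left _ _) h2, (key t h0).1 hlt⟩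
    · rintro ⟨T, h0, hT, hP⟩
      refine ⟨T, (key T h0).1 hT, fun t ht => ?_⟩
      exact hP t ht.1.le ((key t (h0.trans ht.1)).2 ht.2)

/-- auxiliary sums -/
def gS (a : ℕ → ℝ) (k : ℕ) (u : ℝ) : ℝ := ∑' n : ℕ, (n : ℝ) ^ k * a n * (exp u) ^ n

lemma gS_summable {a : ℕ → ℝ} {R : ℝ≥0∞} (hK : IsKClass a R) (k : ℕ) {t : ℝ} (ht : 0 < t)
    (hu : ENNReal.ofReal t < R) :
    Summable (fun n : ℕ => (n : ℝ) ^ k * a n * t ^ n) := by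
  have := hK.2.2.2.1 k t ht hu
  simpa [Real.rpow_natCast] using this

lemma gS_deriv {a : ℕ → ℝ} {R : ℝ≥0∞} (hK : IsKClass a R) (k : ℕ) {u : ℝ}
    (hu : ENNReal.ofReal (exp u) < R) : HasDerivAt (gS a k) (gS a (k+1) u) u := by
  obtain ⟨U, huU, hU⟩ : ∃ U, u < U ∧ ENNReal.ofReal (exp U) < R := by
    have hc : Continuous (fun u : ℝ => ENNReal.ofReal (exp u)) :=
      ENNReal.continuous_ofReal.comp Real.continuous_exp
    have h1 : ∀ᶠ x in 𝓝[>] u, ENNReal.ofReal (exp x) < R :=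
      ((hc.tendsto u).eventually_lt_const hu).filter_mono nhdsWithin_le_nhds
    obtain ⟨U, h2, h3⟩ := (h1.and self_mem_nhdsWithin).exists
    exact ⟨U, h3, h2⟩
  have ha := hK.1
  unfold gS
  refine hasDerivAt_tsum_of_isPreconnected (t := Set.Iio U) (y₀ := u)
    (g := fun (n : ℕ) (u : ℝ) => (n : ℝ) ^ k * a n * (exp u) ^ n)
    (g' := fun (n : ℕ) (u : ℝ) => (n : ℝ) ^ (k+1) * a n * (exp u) ^ n)
    (gS_summable hK (k+1) (exp_pos U) hU) isOpen_Iio isPreconnected_Iio ?_ ?_ huU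
    (gS_summable hK k (exp_pos u) hu) huU
  · intro n y _
    have h1 : HasDerivAt (fun u : ℝ => (n : ℝ) ^ k * a n * exp (n * u))
        ((n : ℝ) ^ k * a n * (exp (n * y) * (n * 1))) y :=
      (((hasDerivAt_id y).const_mul (n : ℝ)).exp).const_mul _
    simp only [← Real.exp_nat_mul]
    have e : (n : ℝ) ^ (k+1) * a n * exp (n * y)
        = (n : ℝ) ^ k * a n * (exp (n * y) * (n * 1)) := by ring
    rw [e]
    exact h1
  · intro n y hy
    have := ha n
    rw [Real.norm_of_nonneg (by positivity)]
    have : exp y ≤ exp U := exp_le_exp.2 (le_of_lt hy)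
    gcongr

lemma gS_pos {a : ℕ → ℝ} {R : ℝ≥0∞} (hK : IsKClass a R) (k : ℕ) {u : ℝ}
    (hu : ENNReal.ofReal (exp u) < R) : 0 < gS a k u := by
  obtain ⟨N, hN, hpos⟩ := hK.2.2.1
  have ha := hK.1
  refine (gS_summable hK k (exp_pos u) hu).tsum_pos (fun n => ?_) N ?_
  · have := ha n
    positivity
  · have : (0:ℝ) < N := by exact_mod_cast hN
    positivity

lemma fsum_eq (a : ℕ → ℝ) (u : ℝ) : fsum a (exp u) = gS a 0 u := by
  simp [fsum, gS]

lemma mf_eq (a : ℕ → ℝ) (u : ℝ) : mf a (exp u) = gS a 1 u / gS a 0 u := by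
  simp [mf, moment, fsum_eq]
  simp [gS]

lemma m2_eq (a : ℕ → ℝ) (u : ℝ) : moment a 2 (exp u) = gS a 2 u / gS a 0 u := by
  simp [moment, fsum_eq]
  simp [gS]

/-- variance as a sum of squares -/
lemma var_hasSum {a : ℕ → ℝ} {R : ℝ≥0∞} (hK : IsKClass a R) {u : ℝ}
    (hu : ENNReal.ofReal (exp u) < R) :
    HasSum (fun n : ℕ => ((n : ℝ) / mf a (exp u) - 1) ^ 2 * (a n * (exp u) ^ n))
      (gS a 0 u * (varf a (exp u) / mf a (exp u) ^ 2)) := by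
  have h0 := (gS_summable hK 0 (exp_pos u) hu).hasSum
  have h1 := (gS_summable hK 1 (exp_pos u) hu).hasSum
  have h2 := (gS_summable hK 2 (exp_pos u) hu).hasSum
  have p0 := gS_pos hK 0 hu
  have p1 := gS_pos hK 1 hu
  set m := mf a (exp u) with hm
  have h := ((h2.mul_left (1 / m ^ 2)).sub (h1.mul_left (2 / m))).add h0
  have pm : 0 < m := by rw [hm, mf_eq]; positivity
  have e0 : (fun n : ℕ => ((n : ℝ) / m - 1) ^ 2 * (a n * (exp u) ^ n)) = fun n : ℕ =>
      1 / m ^ 2 * ((n : ℝ) ^ 2 * a n * exp u ^ n) - 2 / m * ((n : ℝ) ^ 1 * a n * exp u ^ n)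
        + (n : ℝ) ^ 0 * a n * exp u ^ n := by
    funext n
    field_simp
    ring
  have e2 : gS a 0 u * (varf a (exp u) / m ^ 2)
      = 1 / m ^ 2 * gS a 2 u - 2 / m * gS a 1 u + gS a 0 u := by
    have e1 : gS a 1 u = m * gS a 0 u := by rw [hm, mf_eq]; field_simp
    rw [varf, m2_eq, ← hm, e1]
    field_simp
    ring
  rw [e0, e2]
  exact h

lemma var_lower {a : ℕ → ℝ} {R : ℝ≥0∞} (hK : IsKClass a R) {u : ℝ}
    (hu : ENNReal.ofReal (exp u) < R) :
    a 0 ≤ gS a 0 u * (varf a (exp u) / mf a (exp u) ^ 2) := by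
  have h := var_hasSum hK hu
  have := le_hasSum h 0 (fun n _ => by have := hK.1 n; positivity)
  simpa using this

lemma growth {a : ℕ → ℝ} {R : ℝ≥0∞} (hK : IsKClass a R) {u v : ℝ} (huv : u ≤ v)
    (hv : ENNReal.ofReal (exp v) < R)
    (hvar : ∀ x, u ≤ x → ENNReal.ofReal (exp x) < R →
      varf a (exp x) / mf a (exp x) ^ 2 ≤ 1 / 2)
    (hle : v ≤ u + 1 / mf a (exp u)) : gS a 0 v ≤ exp 2 * gS a 0 u := by
  have hD : ∀ x ∈ Set.Icc u v, ENNReal.ofReal (exp x) < R := fun x hx =>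
    lt_of_le_of_lt (ENNReal.ofReal_le_ofReal (exp_le_exp.2 hx.2)) hv
  have hum : u ∈ Set.Icc u v := ⟨le_rfl, huv⟩
  have hvm : v ∈ Set.Icc u v := ⟨huv, le_rfl⟩
  have p0 : ∀ x ∈ Set.Icc u v, 0 < gS a 0 x := fun x hx => gS_pos hK 0 (hD x hx)
  have p1 : ∀ x ∈ Set.Icc u v, 0 < gS a 1 x := fun x hx => gS_pos hK 1 (hD x hx)
  set m := mf a (exp u) with hm
  have pm : 0 < m := by
    have := p0 u hum
    have := p1 u hum
    rw [hm, mf_eq]; positivity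
  have d1 : ∀ x ∈ Set.Icc u v, HasDerivAt (fun x => gS a 0 x / gS a 1 x + x / 2)
      ((gS a 1 x * gS a 1 x - gS a 0 x * gS a 2 x) / gS a 1 x ^ 2 + 1 / 2) x := fun x hx =>
    ((gS_deriv hK 0 (hD x hx)).div (gS_deriv hK 1 (hD x hx)) (p1 x hx).ne').add
      ((hasDerivAt_id x).div_const 2)
  have mono : MonotoneOn (fun x => gS a 0 x / gS a 1 x + x / 2) (Set.Icc u v) := by
    refine monotoneOn_of_deriv_nonneg (convex_Icc u v)
      (fun x hx => (d1 x hx).continuousAt.continuousWithinAt)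
      (fun x hx => (d1 x (interior_subset hx)).differentiableAt.differentiableWithinAt) ?_
    intro x hx
    have hx := interior_subset hx
    rw [(d1 x hx).deriv]
    have h := hvar x hx.1 (hD x hx)
    have q0 := p0 x hx
    have q1 := p1 x hx
    have e : varf a (exp x) / mf a (exp x) ^ 2
        = - ((gS a 1 x * gS a 1 x - gS a 0 x * gS a 2 x) / gS a 1 x ^ 2) := by
      rw [varf, m2_eq, mf_eq]
      field_simp
      ring
    linarith
  have hmb : ∀ x ∈ Set.Icc u v, gS a 1 x / gS a 0 x ≤ 2 * m := by
    intro x hx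
    have h := mono hum hx hx.1
    have e : gS a 0 u / gS a 1 u = 1 / m := by rw [hm, mf_eq, one_div_div]
    simp only [e] at h
    have h3 : 1 / m / 2 ≤ gS a 0 x / gS a 1 x := by
      have := hx.2
      linarith
    have q0 := p0 x hx
    have q1 := p1 x hx
    rw [div_div, div_le_div_iff₀ (by positivity) q1] at h3
    rw [div_le_iff₀ q0]
    linarith
  have d2 : ∀ x ∈ Set.Icc u v, HasDerivAt (fun x => Real.log (gS a 0 x) - x * (2 * m))
      (gS a 1 x / gS a 0 x - 1 * (2 * m)) x := fun x hx =>
    ((gS_deriv hK 0 (hD x hx)).log (p0 x hx).ne').sub ((hasDerivAt_id x).mul_const _)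
  have anti : AntitoneOn (fun x => Real.log (gS a 0 x) - x * (2 * m)) (Set.Icc u v) := by
    refine antitoneOn_of_deriv_nonpos (convex_Icc u v)
      (fun x hx => (d2 x hx).continuousAt.continuousWithinAt)
      (fun x hx => (d2 x (interior_subset hx)).differentiableAt.differentiableWithinAt) ?_
    intro x hx
    have hx := interior_subset hx
    rw [(d2 x hx).deriv]
    have := hmb x hx
    linarith
  have h := anti hum hvm huv
  simp only at h
  have h4 : (v - u) * (2 * m) ≤ 2 := by
    have : (v - u) * (2 * m) ≤ (1 / m) * (2 * m) := by
      gcongr; linarith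
    have e : (1 / m) * (2 * m) = 2 := by field_simp
    linarith
  have h5 : Real.log (gS a 0 v) ≤ 2 + Real.log (gS a 0 u) := by nlinarith
  rw [← Real.exp_log (p0 v hvm), ← Real.exp_log (p0 u hum), ← Real.exp_add]
  simpa [Real.exp_log (p0 u hum), Real.exp_log (p0 v hvm)] using exp_le_exp.2 h5

lemma pointwise (p : ℝ) (hp : 0 < p) (δ : ℝ) (hδ : 0 < δ) :
    ∃ K, 0 < K ∧ ∀ y : ℝ, 0 ≤ y → |y ^ p - 1| ≤ δ * exp y + K * (y - 1) ^ 2 := by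
  have hc : ContinuousAt (fun y : ℝ => y ^ p) 1 :=
    Real.continuousAt_rpow_const _ _ (Or.inl one_ne_zero)
  obtain ⟨r, hr, hnear⟩ := Metric.continuousAt_iff.1 hc δ hδ
  have hl : ∀ᶠ y : ℝ in atTop, y ^ p ≤ δ * exp y := by
    have := (isLittleO_rpow_exp_atTop p).bound hδ
    filter_upwards [this, eventually_ge_atTop 0] with y h1 h2
    rwa [Real.norm_of_nonneg (by positivity), Real.norm_of_nonneg (by positivity)] at h1
  obtain ⟨B, hB⟩ := eventually_atTop.1 hl
  set C := max B 1 with hC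
  have hC1 : 1 ≤ C := le_max_right _ _
  refine ⟨(C ^ p + 1) / r ^ 2, by positivity, fun y hy => ?_⟩
  by_cases h1 : |y - 1| < r
  · have h2 := hnear (x := y) (by rwa [Real.dist_eq])
    rw [Real.dist_eq, Real.one_rpow] at h2
    have : (1:ℝ) ≤ exp y := Real.one_le_exp hy
    have h3 : 0 ≤ (C ^ p + 1) / r ^ 2 * (y - 1) ^ 2 := by positivity
    nlinarith
  · push Not at h1
    by_cases h2 : y ≤ C
    · have h3 : y ^ p ≤ C ^ p := Real.rpow_le_rpow hy h2 hp.le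
      have h4 : 0 ≤ y ^ p := by positivity
      have h5 : |y ^ p - 1| ≤ C ^ p + 1 := by
        rw [abs_le]; constructor <;> linarith
      have h6 : r ^ 2 ≤ (y - 1) ^ 2 := by
        rw [← sq_abs (y - 1)]; gcongr
      have h7 : C ^ p + 1 ≤ (C ^ p + 1) / r ^ 2 * (y - 1) ^ 2 := by
        rw [div_mul_eq_mul_div, le_div_iff₀ (by positivity)]
        gcongr
      have : 0 ≤ δ * exp y := by positivity
      linarith
    · push Not at h2
      have h3 := hB y (le_trans (le_max_left _ _) h2.le)
      have h4 : 1 ≤ y ^ p := Real.one_le_rpow (by linarith) hp.le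
      rw [abs_of_nonneg (by linarith)]
      have : 0 ≤ (C ^ p + 1) / r ^ 2 * (y - 1) ^ 2 := by positivity
      linarith

lemma final_bound {a : ℕ → ℝ} {R : ℝ≥0∞} (hK : IsKClass a R) {u p δ K : ℝ}
    (hu : ENNReal.ofReal (exp u) < R)
    (hv : ENNReal.ofReal (exp (u + 1 / mf a (exp u))) < R)
    (hg : gS a 0 (u + 1 / mf a (exp u)) ≤ exp 2 * gS a 0 u) (hδ : 0 < δ)
    (hpt : ∀ y : ℝ, 0 ≤ y → |y ^ p - 1| ≤ δ * exp y + K * (y - 1) ^ 2) :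
    |moment a p (exp u) / mf a (exp u) ^ p - 1|
      ≤ δ * exp 2 + K * (varf a (exp u) / mf a (exp u) ^ 2) := by
  have hV := var_hasSum hK hu
  have p0 := gS_pos hK 0 hu
  have p1 := gS_pos hK 1 hu
  have pm : 0 < mf a (exp u) := by rw [mf_eq]; positivity
  have h0 := (gS_summable hK 0 (exp_pos u) hu).hasSum
  have hE := (gS_summable hK 0 (exp_pos _) hv).hasSum
  have hP := (hK.2.2.2.1 p (exp u) (exp_pos u) hu).hasSum
  have hmom : ∑' n : ℕ, (n : ℝ) ^ p * a n * exp u ^ n = moment a p (exp u) * gS a 0 u := by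
    rw [moment, fsum_eq]; field_simp
  rw [hmom] at hP
  set m := mf a (exp u) with hm
  have hA := (hP.mul_left (1 / m ^ p)).sub h0
  have hB := (hE.mul_left δ).add (hV.mul_left K)
  have hterm : ∀ n : ℕ, |1 / m ^ p * ((n : ℝ) ^ p * a n * exp u ^ n)
      - (n : ℝ) ^ 0 * a n * exp u ^ n| ≤
      δ * ((n : ℝ) ^ 0 * a n * exp (u + 1 / m) ^ n)
        + K * (((n : ℝ) / m - 1) ^ 2 * (a n * exp u ^ n)) := by
    intro n
    have h := hpt (n / m) (by positivity)
    rw [Real.div_rpow (by positivity) pm.le] at h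
    have ha := hK.1 n
    have e1 : 1 / m ^ p * ((n : ℝ) ^ p * a n * exp u ^ n) - (n : ℝ) ^ 0 * a n * exp u ^ n
        = ((n : ℝ) ^ p / m ^ p - 1) * (a n * exp u ^ n) := by ring
    have e2 : exp (u + 1 / m) ^ n = exp (n / m) * exp u ^ n := by
      rw [← Real.exp_nat_mul, ← Real.exp_nat_mul, ← Real.exp_add]; congr 1; ring
    have hw : 0 ≤ a n * exp u ^ n := by positivity
    rw [e1, e2, abs_mul, abs_of_nonneg hw]
    calc _ ≤ (δ * exp (n / m) + K * ((n : ℝ) / m - 1) ^ 2) * (a n * exp u ^ n) := by gcongr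
      _ = _ := by ring
  have hle1 := hasSum_le (fun n => (abs_le.1 (hterm n)).2) hA hB
  have hle2 := hasSum_le (fun n => (abs_le.1 (hterm n)).1) hB.neg hA
  have habs := abs_le.2 ⟨hle2, hle1⟩
  change |1 / m ^ p * (moment a p (exp u) * gS a 0 u) - gS a 0 u| ≤
    δ * gS a 0 (u + 1 / m) + K * (gS a 0 u * (varf a (exp u) / m ^ 2)) at habs
  have e3 : 1 / m ^ p * (moment a p (exp u) * gS a 0 u) - gS a 0 u
      = (moment a p (exp u) / m ^ p - 1) * gS a 0 u := by ring
  rw [e3, abs_mul, abs_of_pos p0] at habs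
  have h9 : δ * gS a 0 (u + 1 / m) ≤ δ * (exp 2 * gS a 0 u) := by gcongr
  refine le_of_mul_le_mul_right ?_ p0
  nlinarith

/-- if `f ∈ K` is a clan, then for every real `p > 0`,
`lim_{t↑R} E(X_t^p)/E(X_t)^p = 1`. -/
theorem clan_moments_tendsto_one (a : ℕ → ℝ) (R : ℝ≥0∞) (hR : 0 < R)
    (hK : IsKClass a R) (hclan : IsClan a R) :
    ∀ p : ℝ, 0 < p →
      Tendsto (fun t => moment a p t / mf a t ^ p) (nhdsLT R) (𝓝 1) := by
  intro p hp
  -- the ratio of variance and squared mean is eventually small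
  have hsmall : ∀ ε : ℝ, 0 < ε → ∃ T, 0 < T ∧ ENNReal.ofReal T < R ∧
      ∀ x, T ≤ exp x → ENNReal.ofReal (exp x) < R →
        varf a (exp x) / mf a (exp x) ^ 2 ≤ ε := by
    intro ε hε
    have h1 : Tendsto (fun t => (sigmaf a t / mf a t) ^ 2) (nhdsLT R) (𝓝 0) := by
      have := hclan.pow 2
      simpa using this
    obtain ⟨T, hT0, hTR, hT⟩ := (nhdsLT_ev R hR _).1 (h1.eventually_lt_const hε)
    refine ⟨T, hT0, hTR, fun x hx hxR => ?_⟩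
    have h := hT (exp x) hx hxR
    have p0 := gS_pos hK 0 hxR
    have p1 := gS_pos hK 1 hxR
    have pm : 0 < mf a (exp x) := by rw [mf_eq]; positivity
    have hlow := lt_of_lt_of_le hK.2.1 (var_lower hK hxR)
    have hq : 0 < varf a (exp x) / mf a (exp x) ^ 2 := by
      by_contra hcon
      push Not at hcon
      nlinarith
    have hv : 0 ≤ varf a (exp x) := by
      by_contra hcon
      push Not at hcon
      have := div_neg_of_neg_of_pos hcon (by positivity : 0 < mf a (exp x) ^ 2)
      linarith
    rw [div_pow, sigmaf, Real.sq_sqrt hv] at h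
    exact h.le
  rw [Metric.tendsto_nhds]
  intro ε hε
  obtain ⟨K, hK0, hpt⟩ := pointwise p hp (ε / (4 * exp 2)) (by positivity)
  obtain ⟨T1, hT10, hT1R, hT1⟩ := hsmall (1 / 2) (by norm_num)
  obtain ⟨T2, hT20, hT2R, hT2⟩ := hsmall (ε / (4 * K)) (by positivity)
  refine (nhdsLT_ev R hR _).2 ⟨max T1 T2, by positivity, ?_, ?_⟩
  · rcases max_choice T1 T2 with h | h <;> rw [h] <;> assumption
  intro t ht htR
  have ht0 : 0 < t := lt_of_lt_of_le (by positivity) ht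
  obtain ⟨u, rfl⟩ : ∃ u, t = exp u := ⟨Real.log t, (Real.exp_log ht0).symm⟩
  have ht1 : T1 ≤ exp u := le_trans (le_max_left _ _) ht
  have ht2 : T2 ≤ exp u := le_trans (le_max_right _ _) ht
  have hvar : ∀ x, u ≤ x → ENNReal.ofReal (exp x) < R →
      varf a (exp x) / mf a (exp x) ^ 2 ≤ 1 / 2 := fun x hx hxR =>
    hT1 x (ht1.trans (exp_le_exp.2 hx)) hxR
  have p0 := gS_pos hK 0 htR
  have p1 := gS_pos hK 1 htR
  have pm : 0 < mf a (exp u) := by rw [mf_eq]; positivity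
  have hm1 : 0 < 1 / mf a (exp u) := by positivity
  have hvR : ENNReal.ofReal (exp (u + 1 / mf a (exp u))) < R := by
    by_contra hcon
    push Not at hcon
    have ha0 := hK.2.1
    obtain ⟨T3, hT30, hT3R, hT3⟩ := hsmall (a 0 / (2 * (exp 2 * gS a 0 u))) (by positivity)
    obtain ⟨x, hx3, hxu, hxR⟩ : ∃ x, T3 ≤ exp x ∧ u ≤ x ∧ ENNReal.ofReal (exp x) < R := by
      refine ⟨max u (Real.log T3), ?_, le_max_left _ _, ?_⟩
      · calc T3 = exp (Real.log T3) := (Real.exp_log hT30).symm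
          _ ≤ _ := exp_le_exp.2 (le_max_right _ _)
      · rcases max_choice u (Real.log T3) with h | h <;> rw [h]
        · exact htR
        · rwa [Real.exp_log hT30]
    have hxle : x ≤ u + 1 / mf a (exp u) := by
      by_contra hc
      push Not at hc
      exact absurd (lt_of_le_of_lt ((hcon.trans
        (ENNReal.ofReal_le_ofReal (exp_le_exp.2 hc.le)))) hxR) (lt_irrefl _)
    have hgr := growth hK hxu hxR hvar hxle
    have h3 := hT3 x hx3 hxR
    have hlow := var_lower hK hxR
    have px := gS_pos hK 0 hxR
    have : gS a 0 x * (varf a (exp x) / mf a (exp x) ^ 2)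
        ≤ (exp 2 * gS a 0 u) * (a 0 / (2 * (exp 2 * gS a 0 u))) :=
      (mul_le_mul_of_nonneg_left h3 px.le).trans
        (mul_le_mul_of_nonneg_right hgr (by positivity))
    have e : (exp 2 * gS a 0 u) * (a 0 / (2 * (exp 2 * gS a 0 u))) = a 0 / 2 := by
      field_simp
    linarith
  have hgr := growth hK (by linarith) hvR hvar le_rfl
  have hfin := final_bound hK htR hvR hgr (by positivity) hpt
  have h2 := hT2 u ht2 htR
  rw [Real.dist_eq]
  have e1 : ε / (4 * exp 2) * exp 2 = ε / 4 := by field_simp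
  have e2 : K * (ε / (4 * K)) = ε / 4 := by field_simp
  have h5 := mul_le_mul_of_nonneg_left h2 hK0.le
  linarith
end
end
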